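/- Let k ≥ 1 and p₁, p₂ ≥ k, let G = K_{p₁} ∘_k K_{p₂}, and let L be the Laplacian matrix of G. Then for any two distinct vertices i, j ∈ A and every matrix X with L·X·L = L, one has X_{ii} + X_{jj} − X_{ij} − X_{ji} = 2/p₁; and for any two distinct vertices i, j ∈ B and every matrix X with L·X·L = L, one has X_{ii} + X_{jj} − X_{ij} − X_{ji} = 2/p₂. That is, the resistance distance between two non-identified vertices lying in the same complete block K_{pᵢ} equals 2/pᵢ. -/

import Mathlib

open Matrix BigOperators

-- The Laplacian matrix `L = D − A` of a finite simple graph, over `ℝ`.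
open Classical in
noncomputable def lapMat {V : Type} [Fintype V] (G : SimpleGraph V) : Matrix V V ℝ :=
  Matrix.of fun i j =>
    if i = j then (Nat.card {v // G.Adj i v} : ℝ)
    else if G.Adj i j then -1 else 0

/-- Vertex set of the `k`-coalescence `K_{p₁} ∘ₖ K_{p₂}`: the identified clique `T`
(of size `k`), the remaining vertices `A` of `K_{p₁}` (size `a = p₁ − k`) and the
remaining vertices `B` of `K_{p₂}` (size `b = p₂ − k`). -/
abbrev CoalV (k a b : ℕ) := Fin k ⊕ (Fin a ⊕ Fin b)

/-- `u` lies in the part `A`. -/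
def memA {k a b : ℕ} : CoalV k a b → Prop
  | Sum.inr (Sum.inl _) => True
  | _ => False

/-- `u` lies in the part `B`. -/
def memB {k a b : ℕ} : CoalV k a b → Prop
  | Sum.inr (Sum.inr _) => True
  | _ => False

/-- The `k`-coalescence `K_{p₁} ∘ₖ K_{p₂}` (with `a = p₁ − k`, `b = p₂ − k`):
two distinct vertices are adjacent iff they do not lie one in `A` and one in `B`. -/
def KCoal (k a b : ℕ) : SimpleGraph (CoalV k a b) :=
  SimpleGraph.fromRel (fun u v => ¬((memA u ∧ memB v) ∨ (memB u ∧ memA v)))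

/-- The Laplacian matrix of a graph is symmetric. -/
theorem lapMat_transpose {V : Type} [Fintype V] (G : SimpleGraph V) :
    (lapMat G)ᵀ = lapMat G := by
  classical
  ext u v
  by_cases h : u = v
  · subst h; rfl
  · simp [lapMat, h, Ne.symm h, G.adj_comm u v]

/-- If `e_i - e_j` is an eigenvector of a symmetric matrix `L` for a nonzero eigenvalue `c`,
then every `{1}`-inverse `X` of `L` satisfies `X_ii + X_jj - X_ij - X_ji = 2 / c`. -/
theorem oneInverse_single_sub_single {V : Type} [Fintype V] [DecidableEq V]
    {L X : Matrix V V ℝ} {c : ℝ} {i j : V} (hL : Lᵀ = L) (hc : c ≠ 0) (hij : i ≠ j)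
    (hw : L *ᵥ (Pi.single i 1 - Pi.single j 1) = c • (Pi.single i 1 - Pi.single j 1))
    (hX : L * X * L = L) :
    X i i + X j j - X i j - X j i = 2 / c := by
  have hw' : (Pi.single i 1 - Pi.single j 1) ᵥ* L =
      c • (Pi.single i 1 - Pi.single j 1 : V → ℝ) := by
    rw [← mulVec_transpose, hL, hw]
  have key := congrArg
    (fun M => (Pi.single i 1 - Pi.single j 1) ⬝ᵥ M *ᵥ (Pi.single i 1 - Pi.single j 1)) hX
  simp only [← mulVec_mulVec, hw] at key
  rw [dotProduct_mulVec, hw'] at key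
  simp only [mulVec_smul, smul_dotProduct, dotProduct_smul, mulVec_sub, mulVec_single_one,
    sub_dotProduct, dotProduct_sub, single_one_dotProduct, Matrix.col_apply, Pi.single_eq_same,
    Pi.single_eq_of_ne hij, Pi.single_eq_of_ne hij.symm, smul_eq_mul] at key
  rw [eq_div_iff hc]
  apply mul_left_cancel₀ hc
  linarith

/-- The resistance distance between two adjacent vertices of degree `d` with the same closed
neighbourhood is `2 / (d + 1)`. -/
theorem resistance_of_adjacent_twins {V : Type} [Fintype V] (G : SimpleGraph V) {i j : V}
    (hij : G.Adj i j) (htwin : ∀ v, v ≠ i → v ≠ j → (G.Adj v i ↔ G.Adj v j)) {d : ℕ}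
    (hi : Nat.card {v // G.Adj i v} = d) (hj : Nat.card {v // G.Adj j v} = d)
    {X : Matrix V V ℝ} (hX : lapMat G * X * lapMat G = lapMat G) :
    X i i + X j j - X i j - X j i = 2 / ((d + 1 : ℕ) : ℝ) := by
  classical
  have hne := hij.ne
  refine oneInverse_single_sub_single (lapMat_transpose G) (by positivity) hne ?_ hX
  ext v
  simp only [mulVec_sub, mulVec_single_one, Pi.sub_apply, Matrix.col_apply, Pi.smul_apply,
    smul_eq_mul]
  by_cases hvi : v = i
  · subst hvi
    simp [lapMat, hne, hij, -Nat.card_eq_fintype_card, hi]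
  by_cases hvj : v = j
  · subst hvj
    simp [lapMat, hvi, hij.symm, -Nat.card_eq_fintype_card, hj]
    ring
  simp [lapMat, hvi, hvj, htwin v hvi hvj]

/-- A vertex of the part `A` has degree `p₁ - 1`. -/
theorem card_adj_inl (k a b : ℕ) (i : Fin a) :
    Nat.card {v // (KCoal k a b).Adj (Sum.inr (Sum.inl i)) v} = k + a - 1 := by
  classical
  have : 0 < a := i.pos
  have hsum : (∑ x : Fin a, if i = x then 0 else 1) = a - 1 := by
    simp_rw [← ite_not (i = _) 1 0]
    rw [← Finset.card_filter, Finset.filter_ne, Finset.card_erase_of_mem (Finset.mem_univ i),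
      Finset.card_fin]
  rw [Nat.card_eq_fintype_card, Fintype.card_subtype, Finset.card_filter, Fintype.sum_sum_type,
    Fintype.sum_sum_type]
  simp [KCoal, memA, memB, hsum]
  omega

/-- A vertex of the part `B` has degree `p₂ - 1`. -/
theorem card_adj_inr (k a b : ℕ) (i : Fin b) :
    Nat.card {v // (KCoal k a b).Adj (Sum.inr (Sum.inr i)) v} = k + b - 1 := by
  classical
  have : 0 < b := i.pos
  have hsum : (∑ x : Fin b, if i = x then 0 else 1) = b - 1 := by
    simp_rw [← ite_not (i = _) 1 0]
    rw [← Finset.card_filter, Finset.filter_ne, Finset.card_erase_of_mem (Finset.mem_univ i),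
      Finset.card_fin]
  rw [Nat.card_eq_fintype_card, Fintype.card_subtype, Finset.card_filter, Fintype.sum_sum_type,
    Fintype.sum_sum_type]
  simp [KCoal, memA, memB, hsum]
  omega

/-- In `K_{p₁} ∘ₖ K_{p₂}` with `k ≥ 1` and `p₁, p₂ ≥ k`, the resistance distance between
two distinct non-identified vertices of `K_{p₁}` equals `2/p₁`, and between two distinct
non-identified vertices of `K_{p₂}` equals `2/p₂`. -/
theorem resistance_coal_AA_BB (k p₁ p₂ : ℕ) (hk : 1 ≤ k) (h1 : k ≤ p₁) (h2 : k ≤ p₂) :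
    (∀ (i j : Fin (p₁ - k)), i ≠ j →
      ∀ X : Matrix (CoalV k (p₁ - k) (p₂ - k)) (CoalV k (p₁ - k) (p₂ - k)) ℝ,
        lapMat (KCoal k (p₁ - k) (p₂ - k)) * X * lapMat (KCoal k (p₁ - k) (p₂ - k))
          = lapMat (KCoal k (p₁ - k) (p₂ - k)) →
        X (Sum.inr (Sum.inl i)) (Sum.inr (Sum.inl i))
          + X (Sum.inr (Sum.inl j)) (Sum.inr (Sum.inl j))
          - X (Sum.inr (Sum.inl i)) (Sum.inr (Sum.inl j))
          - X (Sum.inr (Sum.inl j)) (Sum.inr (Sum.inl i)) = 2 / (p₁ : ℝ)) ∧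
    (∀ (i j : Fin (p₂ - k)), i ≠ j →
      ∀ X : Matrix (CoalV k (p₁ - k) (p₂ - k)) (CoalV k (p₁ - k) (p₂ - k)) ℝ,
        lapMat (KCoal k (p₁ - k) (p₂ - k)) * X * lapMat (KCoal k (p₁ - k) (p₂ - k))
          = lapMat (KCoal k (p₁ - k) (p₂ - k)) →
        X (Sum.inr (Sum.inr i)) (Sum.inr (Sum.inr i))
          + X (Sum.inr (Sum.inr j)) (Sum.inr (Sum.inr j))
          - X (Sum.inr (Sum.inr i)) (Sum.inr (Sum.inr j))
          - X (Sum.inr (Sum.inr j)) (Sum.inr (Sum.inr i)) = 2 / (p₂ : ℝ)) := by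
  constructor
  · intro i j hij X hX
    have h := resistance_of_adjacent_twins _ (by simp [KCoal, memA, memB, hij]) ?_
      (card_adj_inl k (p₁ - k) (p₂ - k) i) (card_adj_inl k (p₁ - k) (p₂ - k) j) hX
    · rwa [show k + (p₁ - k) - 1 + 1 = p₁ by omega] at h
    · rintro (v | v | v) hi hj <;> simp_all [KCoal, memA, memB]
  · intro i j hij X hX
    have h := resistance_of_adjacent_twins _ (by simp [KCoal, memA, memB, hij]) ?_
      (card_adj_inr k (p₁ - k) (p₂ - k) i) (card_adj_inr k (p₁ - k) (p₂ - k) j) hX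
    · rwa [show k + (p₂ - k) - 1 + 1 = p₂ by omega] at h
    · rintro (v | v | v) hi hj <;> simp_all [KCoal, memA, memB]
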